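/- If D = (E, 𝓕) is a binary delta-matroid and a, b ∈ E with a ≠ b, then the handle slide D_{ab} is again a binary delta-matroid. -/

import Mathlib

/-- A set system: a finite ground set `E` together with a collection `F`
of finite subsets (intended to be subsets of `E`). -/
structure SetSystem (α : Type*) where
  E : Finset α
  F : Set (Finset α)

namespace SetSystem

variable {α : Type*} [DecidableEq α]

/-- A delta-matroid: a set system with nonempty feasible collection, all feasible
sets contained in the ground set, satisfying the symmetric exchange axiom. -/
def IsDeltaMatroid (D : SetSystem α) : Prop :=
  D.F.Nonempty ∧ (∀ F ∈ D.F, F ⊆ D.E) ∧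
    ∀ F₁ ∈ D.F, ∀ F₂ ∈ D.F, ∀ x ∈ symmDiff F₁ F₂,
      ∃ y ∈ symmDiff F₁ F₂, symmDiff F₁ {x, y} ∈ D.F

/-- The handle slide taking `a` over `b`:
`𝓕_{ab} = 𝓕 Δ {X ∪ {a} : X ⊆ E − {a,b}, X ∪ {b} ∈ 𝓕}`. -/
def slide (D : SetSystem α) (a b : α) : SetSystem α :=
  ⟨D.E, symmDiff D.F
    {Y : Finset α | ∃ X : Finset α, X ⊆ D.E \ {a, b} ∧ X ∪ {b} ∈ D.F ∧ Y = X ∪ {a}}⟩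

/-- Iterated handle slides along a list of pairs. -/
def slides (D : SetSystem α) : List (α × α) → SetSystem α
  | [] => D
  | (a, b) :: L => slides (D.slide a b) L

/-- The twist `D ⋆ A = (E, {A Δ X : X ∈ 𝓕})`. -/
def twist (D : SetSystem α) (A : Finset α) : SetSystem α :=
  ⟨D.E, {Y : Finset α | ∃ X ∈ D.F, Y = symmDiff A X}⟩

/-- Deletion of `e`: `D − e = (E − e, {F : F ⊆ E − e, F ∈ 𝓕})`. -/
def del (D : SetSystem α) (e : α) : SetSystem α :=
  ⟨D.E.erase e, {F : Finset α | F ⊆ D.E.erase e ∧ F ∈ D.F}⟩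

/-- Contraction of `e`: `D/e = (E − e, {F : F ⊆ E − e, F ∪ {e} ∈ 𝓕})`. -/
def contr (D : SetSystem α) (e : α) : SetSystem α :=
  ⟨D.E.erase e, {F : Finset α | F ⊆ D.E.erase e ∧ F ∪ {e} ∈ D.F}⟩

/-- The set system `D(A)` of a symmetric binary matrix `A` indexed by `E`:
feasible sets are the `W ⊆ E` whose principal submatrix `A[W]` is invertible
(the empty submatrix being invertible by convention). -/
def ofMatrix (E : Finset α) (A : Matrix E E (ZMod 2)) : SetSystem α :=
  ⟨E, {W : Finset α | ∃ h : ∀ x ∈ W, x ∈ E,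
        IsUnit (Matrix.submatrix A
          (fun i : W => (⟨i.1, h i.1 i.2⟩ : E)) (fun i : W => (⟨i.1, h i.1 i.2⟩ : E)))}⟩

/-- `D` is binary: `D = D(A) ⋆ F` for some feasible `F ∈ 𝓕` and some
symmetric matrix `A` over GF(2) indexed by the ground set. -/
def IsBinary (D : SetSystem α) : Prop :=
  ∃ F ∈ D.F, ∃ A : Matrix D.E D.E (ZMod 2),
    A.IsSymm ∧ D = (ofMatrix D.E A).twist F

/-- `IsMinor D T`: `T` is obtained from `D` by a sequence of deletions and
contractions (keeping feasible collections nonempty). -/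
inductive IsMinor : SetSystem α → SetSystem α → Prop
  | refl (D : SetSystem α) : IsMinor D D
  | del {D T : SetSystem α} (e : α) (he : e ∈ D.E) (hne : (D.del e).F.Nonempty)
      (h : IsMinor (D.del e) T) : IsMinor D T
  | contr {D T : SetSystem α} (e : α) (he : e ∈ D.E) (hne : (D.contr e).F.Nonempty)
      (h : IsMinor (D.contr e) T) : IsMinor D T

/-- Isomorphism of set systems: a bijection of ground sets carrying one
feasible collection onto the other. -/
def Isomorphic {β : Type*} [DecidableEq β] (D : SetSystem α) (D' : SetSystem β) : Prop :=
  ∃ φ : α → β, Set.InjOn φ D.E ∧ D.E.image φ = D'.E ∧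
    D'.F = {Y : Finset β | ∃ X ∈ D.F, Y = X.image φ}

end SetSystem

open SetSystem

/-- The minimal non-binary delta-matroids of Bouchet–Duchamp. -/
def S₁ : SetSystem ℕ := ⟨{1, 2, 3}, {∅, {1, 2}, {1, 3}, {2, 3}, {1, 2, 3}}⟩
def S₂ : SetSystem ℕ := ⟨{1, 2, 3}, {∅, {1}, {2}, {3}, {1, 2}, {1, 3}, {2, 3}}⟩
def S₃ : SetSystem ℕ := ⟨{1, 2, 3}, {∅, {2}, {3}, {1, 2}, {1, 3}, {1, 2, 3}}⟩
def S₄ : SetSystem ℕ := ⟨{1, 2, 3, 4}, {∅, {1, 2}, {1, 3}, {1, 4}, {2, 3}, {2, 4}, {3, 4}}⟩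
def S₅ : SetSystem ℕ := ⟨{1, 2, 3, 4}, {∅, {1, 2}, {1, 4}, {2, 3}, {3, 4}, {1, 2, 3, 4}}⟩

open Matrix in
/-- If `P * Qᵀ` is symmetric, then an alternating form sums to zero over pairs of corresponding
columns of `P` and `Q`, in characteristic two. -/
theorem LinearMap.sum_apply_col_eq_zero {n : Type*} [Fintype n] [DecidableEq n]
    (B : (n → ZMod 2) →ₗ[ZMod 2] (n → ZMod 2) →ₗ[ZMod 2] ZMod 2) (hB : ∀ u, B u u = 0)
    (P Q : Matrix n n (ZMod 2)) (h : (P * Qᵀ).IsSymm) :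
    ∑ j, B (P.col j) (Q.col j) = 0 := by
  have expand (j : n) : B (P.col j) (Q.col j) =
      ∑ x : n × n, P x.1 j * Q x.2 j * B (Pi.single x.1 1) (Pi.single x.2 1) := by
    have hs (u : n → ZMod 2) : u = ∑ i, u i • Pi.single i (1 : ZMod 2) := by
      ext k
      simp [Finset.sum_apply, Pi.single_apply]
    conv_lhs => rw [hs (P.col j), hs (Q.col j)]
    simp only [map_sum, LinearMap.sum_apply, map_smul, LinearMap.smul_apply, smul_eq_mul,
      Fintype.sum_prod_type, Matrix.col_apply, Finset.mul_sum, mul_assoc]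
    rw [Finset.sum_comm]
    refine Finset.sum_congr rfl fun _ _ => Finset.sum_congr rfl fun _ _ => by ring
  have hswap (u v) : B u v = B v u := by
    have := hB (u + v)
    simp only [map_add, LinearMap.add_apply, hB, zero_add, add_zero] at this
    exact (CharTwo.add_eq_zero.1 this).symm
  simp only [expand]
  rw [Finset.sum_comm]
  simp only [← Finset.sum_mul]
  have hPQ (i k : n) : ∑ j, P i j * Q k j = ∑ j, P k j * Q i j := by
    have := h.apply k i
    simpa [Matrix.mul_apply] using this
  refine Finset.sum_involution (fun x _ => x.swap) ?_ ?_ (by simp) (by simp)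
  · rintro ⟨i, k⟩ -
    simp only [Prod.swap]
    rw [hPQ k i, hswap (Pi.single k 1)]
    exact CharTwo.add_self_eq_zero _
  · rintro ⟨i, k⟩ - hne heq
    obtain rfl : k = i := congrArg Prod.fst heq
    simp [hB] at hne

namespace SetSystem

open Matrix

variable {α : Type*} [DecidableEq α] {E : Finset α}

/-- The matrix with the columns of `P` at the elements of `W` and those of `Q` elsewhere. -/
def mixed (P Q : Matrix E E (ZMod 2)) (W : Finset α) : Matrix E E (ZMod 2) :=
  of fun i j => if j.1 ∈ W then P i j else Q i j

/-- The pair `[P | Q]` is a Lagrangian representation of `D`. -/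
def Represents (D : SetSystem α) (P Q : Matrix D.E D.E (ZMod 2)) : Prop :=
  (P * Qᵀ).IsSymm ∧ ∀ W, W ∈ D.F ↔ W ⊆ D.E ∧ (mixed P Q W).det ≠ 0

theorem isSymm_mul_transpose_iff {n : Type*} [Fintype n] (P Q : Matrix n n (ZMod 2)) :
    (P * Qᵀ).IsSymm ↔ ∀ i k, ∑ j, (P i j * Q k j + P k j * Q i j) = 0 := by
  simp only [Matrix.IsSymm.ext_iff, Matrix.mul_apply, transpose_apply, Finset.sum_add_distrib,
    CharTwo.add_eq_zero]
  exact forall_comm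

theorem isSymm_mixed_mul_transpose {P Q : Matrix E E (ZMod 2)} (h : (P * Qᵀ).IsSymm)
    (W : Finset α) : (mixed Q P W * (mixed P Q W)ᵀ).IsSymm := by
  rw [isSymm_mul_transpose_iff] at h ⊢
  intro i k
  rw [← h i k]
  refine Finset.sum_congr rfl fun j _ => ?_
  by_cases hj : j.1 ∈ W <;> simp [mixed, hj]
  ring

theorem mixed_mixed (P Q : Matrix E E (ZMod 2)) (F W : Finset α) :
    mixed (mixed Q P F) (mixed P Q F) W = mixed P Q (symmDiff F W) := by
  ext i j
  by_cases hF : j.1 ∈ F <;> by_cases hW : j.1 ∈ W <;> simp [mixed, hF, hW, Finset.mem_symmDiff]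

theorem mul_mixed (R P Q : Matrix E E (ZMod 2)) (W : Finset α) :
    R * mixed P Q W = mixed (R * P) (R * Q) W := by
  ext i j
  by_cases hW : j.1 ∈ W <;> simp [mixed, hW, Matrix.mul_apply]

theorem mem_ofMatrix_iff (A : Matrix E E (ZMod 2)) (W : Finset α) :
    W ∈ (ofMatrix E A).F ↔ W ⊆ E ∧ (mixed A 1 W).det ≠ 0 := by
  change (∃ h : ∀ x ∈ W, x ∈ E, _) ↔ _
  rw [← exists_prop]
  refine exists_congr fun h => ?_
  rw [Matrix.isUnit_iff_isUnit_det, isUnit_iff_ne_zero]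
  rw [twoBlockTriangular_det' (mixed A 1 W) (fun i => i.1 ∈ W)]
  · have h1 : toSquareBlockProp (mixed A 1 W) (fun i => ¬ i.1 ∈ W) = 1 := by
      ext i j
      simp only [toSquareBlockProp_def, mixed, of_apply, if_neg j.2, Matrix.one_apply,
        Subtype.ext_iff]
    let e : W ≃ {i : E // i.1 ∈ W} :=
      { toFun := fun i => ⟨⟨i.1, h i.1 i.2⟩, i.2⟩
        invFun := fun i => ⟨i.1.1, i.2⟩
        left_inv := fun _ => rfl
        right_inv := fun _ => rfl }
    rw [h1, det_one, mul_one, ← det_submatrix_equiv_self e]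
    have h2 : (toSquareBlockProp (mixed A 1 W) (fun i => i.1 ∈ W)).submatrix e e =
        A.submatrix (fun i : W => (⟨i.1, h i.1 i.2⟩ : E)) (fun i : W => ⟨i.1, h i.1 i.2⟩) := by
      ext i j
      simp [toSquareBlockProp, mixed, e]
    rw [h2]
  · intro i hi j hj
    have : i ≠ j := by rintro rfl; exact hj hi
    simp [mixed, hj, this]

theorem mem_twist_iff (D : SetSystem α) (F W : Finset α) :
    W ∈ (D.twist F).F ↔ symmDiff F W ∈ D.F := by
  constructor
  · rintro ⟨X, hX, rfl⟩
    simpa using hX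
  · exact fun h => ⟨_, h, by simp⟩

theorem symmDiff_subset_iff {F W : Finset α} (hF : F ⊆ E) : symmDiff F W ⊆ E ↔ W ⊆ E := by
  have key {X : Finset α} (hX : X ⊆ E) : symmDiff F X ⊆ E :=
    fun x hx => by
      rcases Finset.mem_symmDiff.1 hx with h | h
      · exact hF h.1
      · exact hX h.1
  exact ⟨fun h => by simpa using key h, key⟩

theorem IsBinary.exists_represents {D : SetSystem α} (hB : D.IsBinary)
    (hE : ∀ F ∈ D.F, F ⊆ D.E) : ∃ P Q, D.Represents P Q := by
  obtain ⟨F, hF, A, hA, hD⟩ := hB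
  refine ⟨mixed 1 A F, mixed A 1 F, isSymm_mixed_mul_transpose (by simpa using hA) F,
    fun W => ?_⟩
  have : W ∈ D.F ↔ W ∈ ((ofMatrix D.E A).twist F).F := by rw [← hD]
  rw [this, mem_twist_iff, mem_ofMatrix_iff, mixed_mixed, symmDiff_subset_iff (hE F hF)]

theorem Represents.exists_normal_form {D : SetSystem α} {P Q : Matrix D.E D.E (ZMod 2)}
    (h : D.Represents P Q) {F : Finset α} (hF : F ∈ D.F) :
    ∃ A : Matrix D.E D.E (ZMod 2), A.IsSymm ∧
      ∀ W, W ∈ D.F ↔ symmDiff F W ∈ (ofMatrix D.E A).F := by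
  obtain ⟨hFE, hdet⟩ := (h.2 F).1 hF
  have hs := isSymm_mixed_mul_transpose h.1 F
  set R := mixed P Q F with hR
  set S := mixed Q P F with hS
  have hu : IsUnit R.det := isUnit_iff_ne_zero.2 hdet
  refine ⟨R⁻¹ * S, ?_, fun W => ?_⟩
  · have hs' : R * Sᵀ = S * Rᵀ := by simpa [Matrix.IsSymm] using hs
    have hut : IsUnit (Rᵀ).det := by rwa [det_transpose]
    change (R⁻¹ * S)ᵀ = R⁻¹ * S
    rw [transpose_mul, transpose_nonsing_inv]
    calc Sᵀ * Rᵀ⁻¹ = R⁻¹ * (R * Sᵀ) * Rᵀ⁻¹ := by rw [nonsing_inv_mul_cancel_left _ _ hu]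
      _ = R⁻¹ * S := by rw [hs', ← Matrix.mul_assoc, mul_nonsing_inv_cancel_right _ _ hut]
  · rw [h.2, mem_ofMatrix_iff, symmDiff_subset_iff hFE]
    have hm : mixed P Q W = R * mixed (R⁻¹ * S) 1 (symmDiff F W) := by
      rw [mul_mixed, mul_nonsing_inv_cancel_left _ _ hu, mul_one, mixed_mixed,
        symmDiff_symmDiff_cancel_left]
    rw [hm, det_mul, mul_ne_zero_iff, and_iff_right hdet]

theorem Represents.isBinary {D : SetSystem α} {P Q : Matrix D.E D.E (ZMod 2)}
    (h : D.Represents P Q) (hne : D.F.Nonempty) : D.IsBinary := by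
  obtain ⟨F, hF⟩ := hne
  obtain ⟨A, hA, hW⟩ := h.exists_normal_form hF
  refine ⟨F, hF, A, hA, ?_⟩
  have : D.F = ((ofMatrix D.E A).twist F).F := by
    ext W
    rw [mem_twist_iff, hW]
  calc D = ⟨D.E, D.F⟩ := rfl
    _ = _ := by rw [this]; rfl

theorem exists_pair_mem_ofMatrix {A : Matrix E E (ZMod 2)} (hA : A.IsSymm) {W : Finset α}
    (hW : W ∈ (ofMatrix E A).F) {x : α} (hx : x ∈ W) :
    ∃ y ∈ W, {x, y} ∈ (ofMatrix E A).F := by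
  obtain ⟨hE, hu⟩ := hW
  rw [isUnit_iff_isUnit_det, isUnit_iff_ne_zero] at hu
  have hxE := hE x hx
  have small (y : α) (hy : y ∈ E) (hdet : x ≠ y → A ⟨x, hxE⟩ ⟨x, hxE⟩ = 0)
      (hxy : A ⟨x, hxE⟩ ⟨y, hy⟩ ≠ 0) : {x, y} ∈ (ofMatrix E A).F := by
    have hsub : ∀ z ∈ ({x, y} : Finset α), z ∈ E := by simp [hxE, hy]
    refine ⟨hsub, ?_⟩
    by_cases hne : x = y
    · subst hne
      rw [isUnit_iff_isUnit_det, isUnit_iff_ne_zero]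
      let i₀ : ({x, x} : Finset α) := ⟨x, by simp⟩
      have hx' (z : ({x, x} : Finset α)) : z.1 = x := by simpa using z.2
      have : Subsingleton ({x, x} : Finset α) :=
        ⟨fun z w => Subtype.ext ((hx' z).trans (hx' w).symm)⟩
      rw [det_eq_elem_of_subsingleton _ i₀]
      exact hxy
    · let e : Fin 2 ≃ ({x, y} : Finset α) :=
        Equiv.ofBijective ![⟨x, by simp⟩, ⟨y, by simp⟩] <| by
          constructor
          · intro i j
            fin_cases i <;> fin_cases j <;> simp [hne, Ne.symm hne]
          · rintro ⟨z, hz⟩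
            rcases Finset.mem_insert.1 hz with rfl | hz
            · exact ⟨0, rfl⟩
            · obtain rfl := Finset.mem_singleton.1 hz
              exact ⟨1, rfl⟩
      rw [isUnit_iff_isUnit_det, isUnit_iff_ne_zero, ← det_submatrix_equiv_self e, det_fin_two]
      have hyx := hA.apply ⟨x, hxE⟩ ⟨y, hy⟩
      change A ⟨x, hxE⟩ ⟨x, hxE⟩ * A ⟨y, hy⟩ ⟨y, hy⟩ - A ⟨x, hxE⟩ ⟨y, hy⟩ * A ⟨y, hy⟩ ⟨x, hxE⟩ ≠ 0
      simp [hdet hne, hyx, hxy]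
  by_cases hxx : A ⟨x, hxE⟩ ⟨x, hxE⟩ = 0
  · by_contra! hcon
    refine hu (det_eq_zero_of_row_eq_zero ⟨x, hx⟩ fun y => ?_)
    by_contra hne
    exact hcon y.1 y.2 (small y.1 (hE _ y.2) (fun _ => hxx) hne)
  · exact ⟨x, hx, small x hxE (fun h => absurd rfl h) hxx⟩

theorem Represents.isDeltaMatroid {D : SetSystem α} {P Q : Matrix D.E D.E (ZMod 2)}
    (h : D.Represents P Q) (hne : D.F.Nonempty) : D.IsDeltaMatroid := by
  refine ⟨hne, fun F hF => ((h.2 F).1 hF).1, fun F₁ h₁ F₂ h₂ x hx => ?_⟩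
  obtain ⟨A, hA, hW⟩ := h.exists_normal_form h₁
  obtain ⟨y, hy, hxy⟩ := exists_pair_mem_ofMatrix hA ((hW F₂).1 h₂) hx
  exact ⟨y, hy, (hW _).2 (by simpa using hxy)⟩

/-- The determinant of `M` as a bilinear function of its columns `a` and `b`. -/
def detCols {n : Type*} [Fintype n] [DecidableEq n] (M : Matrix n n (ZMod 2)) {a b : n}
    (hab : a ≠ b) : (n → ZMod 2) →ₗ[ZMod 2] (n → ZMod 2) →ₗ[ZMod 2] ZMod 2 :=
  LinearMap.mk₂ (ZMod 2) (fun u v => ((M.updateCol a u).updateCol b v).det)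
    (fun u u' v => by
      simp only [updateCol_comm _ hab, det_updateCol_add])
    (fun c u v => by
      simp only [updateCol_comm _ hab, det_updateCol_smul, smul_eq_mul])
    (fun u v v' => det_updateCol_add _ _ _ _)
    (fun c u v => det_updateCol_smul _ _ _ _)

theorem detCols_apply {n : Type*} [Fintype n] [DecidableEq n] (M : Matrix n n (ZMod 2)) {a b : n}
    (hab : a ≠ b) (u v : n → ZMod 2) :
    detCols M hab u v = ((M.updateCol a u).updateCol b v).det := rfl

theorem detCols_self {n : Type*} [Fintype n] [DecidableEq n] (M : Matrix n n (ZMod 2)) {a b : n}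
    (hab : a ≠ b) (u : n → ZMod 2) : detCols M hab u u = 0 :=
  det_zero_of_column_eq hab fun i => by simp [hab]

theorem detCols_comm {n : Type*} [Fintype n] [DecidableEq n] (M : Matrix n n (ZMod 2)) {a b : n}
    (hab : a ≠ b) (u v : n → ZMod 2) : detCols M hab u v = detCols M hab v u := by
  have := detCols_self M hab (u + v)
  simp only [map_add, LinearMap.add_apply, detCols_self, zero_add, add_zero] at this
  exact (CharTwo.add_eq_zero.1 this).symm

theorem detCols_col_mixed {P Q : Matrix E E (ZMod 2)} (h : (P * Qᵀ).IsSymm) (W : Finset α)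
    {a b : E} (hab : a ≠ b) :
    detCols (mixed P Q W) hab (P.col a) (Q.col a) =
      detCols (mixed P Q W) hab (P.col b) (Q.col b) := by
  have hsum := LinearMap.sum_apply_col_eq_zero (detCols (mixed P Q W) hab) (detCols_self _ hab)
    P Q h
  rw [← Finset.sum_subset (Finset.subset_univ {a, b}), Finset.sum_pair hab,
    CharTwo.add_eq_zero] at hsum
  · exact hsum
  · intro j _ hj
    simp only [Finset.mem_insert, Finset.mem_singleton, not_or] at hj
    rw [detCols_apply]
    by_cases hW : j.1 ∈ W
    · exact det_zero_of_column_eq (Ne.symm hj.1) fun i => by simp [hj, hab, mixed, hW]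
    · exact det_zero_of_column_eq (Ne.symm hj.2) fun i => by simp [hj, mixed, hW]

theorem det_mixed_updateCol {P Q : Matrix E E (ZMod 2)} (h : (P * Qᵀ).IsSymm) (W : Finset α)
    {a b : E} (hab : a ≠ b) :
    (mixed (P.updateCol a (P.col a + P.col b)) (Q.updateCol b (Q.col b + Q.col a)) W).det =
      (mixed P Q W).det +
        if a.1 ∈ W ∧ b.1 ∉ W then (mixed P Q (insert b.1 (W.erase a.1))).det else 0 := by
  set M := mixed P Q W with hM
  have h1 : mixed (P.updateCol a (P.col a + P.col b)) (Q.updateCol b (Q.col b + Q.col a)) W =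
      (M.updateCol a (if a.1 ∈ W then P.col a + P.col b else Q.col a)).updateCol b
        (if b.1 ∈ W then P.col b else Q.col b + Q.col a) := by
    ext i j
    by_cases hjb : j = b
    · subst hjb
      by_cases hj : j.1 ∈ W <;> simp [mixed, hj, hab.symm]
    · by_cases hja : j = a
      · subst hja
        by_cases hj : j.1 ∈ W <;> simp [mixed, hj, hab]
      · simp [mixed, hM, hja, hjb]
  have h2 : M = (M.updateCol a (if a.1 ∈ W then P.col a else Q.col a)).updateCol b
        (if b.1 ∈ W then P.col b else Q.col b) := by
    ext i j
    by_cases hjb : j = b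
    · subst hjb
      by_cases hj : j.1 ∈ W <;> simp [mixed, hM, hj]
    · by_cases hja : j = a
      · subst hja
        by_cases hj : j.1 ∈ W <;> simp [mixed, hM, hj, hab]
      · simp [hja, hjb]
  have h3 : mixed P Q (insert b.1 (W.erase a.1)) =
      (M.updateCol a (Q.col a)).updateCol b (P.col b) := by
    ext i j
    by_cases hjb : j = b
    · subst hjb
      simp [mixed]
    · by_cases hja : j = a
      · subst hja
        simp [mixed, hab]
      · simp [mixed, hM, hja, hjb]
  have h2d : M.det = detCols M hab (if a.1 ∈ W then P.col a else Q.col a)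
      (if b.1 ∈ W then P.col b else Q.col b) := by
    rw [detCols_apply, ← h2]
  rw [h1, h3, h2d, ← detCols_apply M hab, ← detCols_apply M hab]
  have hkey := detCols_col_mixed h W hab
  rw [← hM] at hkey
  by_cases ha : a.1 ∈ W <;> by_cases hb : b.1 ∈ W <;>
    simp only [ha, hb, if_true, if_false, map_add, LinearMap.add_apply, detCols_self, hkey,
      add_zero, not_true_eq_false, not_false_eq_true, and_self, and_true, and_false]
  rw [detCols_comm M hab (Q.col a)]
  linear_combination CharTwo.add_self_eq_zero (detCols M hab (P.col b) (Q.col b))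

theorem isSymm_updateCol_mul_transpose {P Q : Matrix E E (ZMod 2)} (h : (P * Qᵀ).IsSymm)
    {a b : E} (hab : a ≠ b) :
    (P.updateCol a (P.col a + P.col b) * (Q.updateCol b (Q.col b + Q.col a))ᵀ).IsSymm := by
  rw [isSymm_mul_transpose_iff] at h ⊢
  intro i k
  have hterm (j : E) :
      P.updateCol a (P.col a + P.col b) i j * Q.updateCol b (Q.col b + Q.col a) k j +
        P.updateCol a (P.col a + P.col b) k j * Q.updateCol b (Q.col b + Q.col a) i j =
      (P i j * Q k j + P k j * Q i j) + ((if j = a then P i b * Q k a + P k b * Q i a else 0) +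
        if j = b then P i b * Q k a + P k b * Q i a else 0) := by
    by_cases hjb : j = b
    · subst hjb
      simp [hab.symm]
      ring
    · by_cases hja : j = a
      · subst hja
        simp [hab]
        ring
      · simp [hja, hjb]
  simp only [hterm, Finset.sum_add_distrib (f := fun j => P i j * Q k j + P k j * Q i j), h,
    Finset.sum_add_distrib, Finset.sum_ite_eq', Finset.mem_univ, if_true, zero_add]
  exact CharTwo.add_self_eq_zero _

theorem mem_slide_iff {D : SetSystem α} (hE : ∀ F ∈ D.F, F ⊆ D.E) {a b : α}
    (hab : a ≠ b) (W : Finset α) :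
    W ∈ (D.slide a b).F ↔ Xor (W ∈ D.F) (a ∈ W ∧ b ∉ W ∧ insert b (W.erase a) ∈ D.F) := by
  have : (∃ X : Finset α, X ⊆ D.E \ {a, b} ∧ X ∪ {b} ∈ D.F ∧ W = X ∪ {a}) ↔
      a ∈ W ∧ b ∉ W ∧ insert b (W.erase a) ∈ D.F := by
    constructor
    · rintro ⟨X, hX, hF, rfl⟩
      have haX : a ∉ X := fun h => by simpa using hX h
      have hbX : b ∉ X := fun h => by simpa using hX h
      have : insert b ((X ∪ {a}).erase a) = X ∪ {b} := by
        ext z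
        by_cases hz : z = a <;> simp [hz, haX, or_comm]
      exact ⟨by simp, by simp [hbX, hab.symm], by rwa [this]⟩
    · rintro ⟨haW, hbW, hF⟩
      refine ⟨W.erase a, fun z hz => ?_, by rwa [Finset.union_singleton], ?_⟩
      · have hzE := hE _ hF (Finset.mem_insert_of_mem hz)
        have hzb : z ≠ b := by rintro rfl; exact hbW (Finset.mem_of_mem_erase hz)
        simp [hzE, hzb, Finset.ne_of_mem_erase hz]
      · rw [Finset.union_singleton, Finset.insert_erase haW]
  rw [← this]
  rfl

theorem slide_nonempty {D : SetSystem α} (hE : ∀ F ∈ D.F, F ⊆ D.E) (hne : D.F.Nonempty)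
    {a b : α} (hab : a ≠ b) : (D.slide a b).F.Nonempty := by
  obtain ⟨W, hW⟩ := hne
  by_cases h : a ∈ W ∧ b ∉ W ∧ insert b (W.erase a) ∈ D.F
  · exact ⟨_, (mem_slide_iff hE hab _).2 (Or.inl ⟨h.2.2, by simp [hab]⟩)⟩
  · exact ⟨W, (mem_slide_iff hE hab _).2 (Or.inl ⟨hW, h⟩)⟩

theorem Represents.slide {D : SetSystem α} {P Q : Matrix D.E D.E (ZMod 2)}
    (h : D.Represents P Q) {a b : D.E} (hab : a ≠ b) :
    (D.slide a b).Represents (P.updateCol a (P.col a + P.col b))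
      (Q.updateCol b (Q.col b + Q.col a)) := by
  refine ⟨isSymm_updateCol_mul_transpose h.1 hab, fun W => ?_⟩
  rw [mem_slide_iff (fun F hF => ((h.2 F).1 hF).1) (fun hh => hab (Subtype.ext hh))]
  change _ ↔ W ⊆ D.E ∧ (mixed (E := D.E) _ _ W).det ≠ 0
  rw [det_mixed_updateCol h.1 W hab, h.2, h.2]
  have hsub : a.1 ∈ W → (insert b.1 (W.erase a.1) ⊆ D.E ↔ W ⊆ D.E) := fun haW => by
    rw [Finset.insert_subset_iff, and_iff_right b.2]
    conv_rhs => rw [← Finset.insert_erase haW, Finset.insert_subset_iff, and_iff_right a.2]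
  have two (x y : ZMod 2) : x + y ≠ 0 ↔ Xor (x ≠ 0) (y ≠ 0) := by
    revert x y
    unfold Xor
    decide
  rw [two]
  by_cases haW : a.1 ∈ W
  · rw [hsub haW]
    by_cases hbW : b.1 ∈ W <;> by_cases hWE : W ⊆ D.E <;> simp [haW, hbW, hWE, Xor]
  · simp [haW, Xor]

end SetSystem

/-- a handle slide of a binary delta-matroid is again a binary
delta-matroid. -/
theorem stmt_1 {α : Type*} [DecidableEq α] (D : SetSystem α)
    (hD : D.IsDeltaMatroid) (hB : D.IsBinary)
    (a b : α) (ha : a ∈ D.E) (hb : b ∈ D.E) (hab : a ≠ b) :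
    (D.slide a b).IsDeltaMatroid ∧ (D.slide a b).IsBinary := by
  obtain ⟨P, Q, h⟩ := hB.exists_represents hD.2.1
  have hs := h.slide (a := ⟨a, ha⟩) (b := ⟨b, hb⟩) (by simpa using hab)
  have hne := slide_nonempty hD.2.1 hD.1 hab
  exact ⟨hs.isDeltaMatroid hne, hs.isBinary hne⟩
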